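/- Let N ∈ ℕ and let L : (Fin N → ℝ) → ℝ be differentiable. Define F : (Fin N → ℝ) → ℝ by F(m) = L(m) + ∑_{i=1}^{N} [(1 − m i) ln(1 − m i) + m i ln(m i)]. Let m : Fin N → ℝ satisfy 0 < m i < 1 for all i. Then all partial derivatives of F vanish at m (m is a stationary point of F) if and only if for every i, m i = 1 / (1 + exp(∂_i L(m))), where ∂_i L(m) denotes the partial derivative of L with respect to the i-th coordinate at m. -/

import Mathlib

/-- Derivative of the negative binary entropy. -/
theorem hasDerivAt_neg_binary_entropy {x : ℝ} (h0 : x ≠ 0) (h1 : 1 - x ≠ 0) :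
    HasDerivAt (fun x : ℝ => (1 - x) * Real.log (1 - x) + x * Real.log x)
      (Real.log x - Real.log (1 - x)) x := by
  have h := (Real.hasDerivAt_mul_log h1).comp x ((hasDerivAt_id x).const_sub 1)
  convert! h.add (Real.hasDerivAt_mul_log h0) using 1
  ring

/-- The logit equation `d + ln (x / (1 - x)) = 0` is solved by the logistic function of `-d`. -/
theorem add_logit_eq_zero_iff {x : ℝ} (h0 : 0 < x) (h1 : x < 1) (d : ℝ) :
    d + (Real.log x - Real.log (1 - x)) = 0 ↔ x = 1 / (1 + Real.exp d) := by
  have h2 : 0 < 1 - x := by linarith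
  have hd : d + (Real.log x - Real.log (1 - x)) = 0 ↔ d = Real.log ((1 - x) / x) := by
    rw [Real.log_div h2.ne' h0.ne']
    constructor <;> intro h <;> linarith
  rw [hd, ← Real.exp_eq_exp, Real.exp_log (div_pos h2 h0), eq_div_iff h0.ne',
    eq_div_iff (by positivity)]
  constructor <;> intro h <;> linarith

/-- For a differentiable Lagrangian `L` and the mean field free energy
`F m = L m + ∑ i, [(1 - m i) ln (1 - m i) + m i ln (m i)]`, a point `m` with
`0 < m i < 1` for all `i` is a stationary point of `F` (all partial derivatives
vanish) iff it satisfies the self-consistency equations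
`m i = 1 / (1 + exp (∂_i L m))`. -/
theorem mean_field_stationarity (N : ℕ) (L : (Fin N → ℝ) → ℝ)
    (hL : Differentiable ℝ L)
    (F : (Fin N → ℝ) → ℝ)
    (hF : ∀ m, F m = L m
      + ∑ i, ((1 - m i) * Real.log (1 - m i) + m i * Real.log (m i)))
    (m : Fin N → ℝ) (hm : ∀ i, 0 < m i ∧ m i < 1) :
    (∀ i, fderiv ℝ F m (Pi.single i 1) = 0)
      ↔ ∀ i, m i = 1 / (1 + Real.exp (fderiv ℝ L m (Pi.single i 1))) := by
  have hsum : HasFDerivAt F (fderiv ℝ L m + ∑ j, (Real.log (m j) - Real.log (1 - m j)) •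
      (ContinuousLinearMap.proj j : (Fin N → ℝ) →L[ℝ] ℝ)) m := by
    rw [funext hF]
    refine (hL m).hasFDerivAt.add (HasFDerivAt.fun_sum fun j _ => ?_)
    have hj : HasFDerivAt (fun y : Fin N → ℝ => y j)
        (ContinuousLinearMap.proj j : (Fin N → ℝ) →L[ℝ] ℝ) m := hasFDerivAt_apply j m
    exact HasDerivAt.comp_hasFDerivAt (f := fun y : Fin N → ℝ => y j) m
      (hasDerivAt_neg_binary_entropy (hm j).1.ne' (sub_pos.2 (hm j).2).ne') hj
  refine forall_congr' fun i => ?_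
  rw [← add_logit_eq_zero_iff (hm i).1 (hm i).2, hsum.fderiv]
  simp [Pi.single_apply]
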